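/- Let A ∈ M satisfy J_k(A) ≠ 0 for all 1 ≤ k ≤ n. Then the Ad_U-orbit of A meets L in exactly one point: there exists u ∈ U with uAu⁻¹ ∈ L, and if u, v ∈ U satisfy uAu⁻¹ ∈ L and vAv⁻¹ ∈ L, then uAu⁻¹ = vAv⁻¹. -/

import Mathlib

open Matrix

/-- `u` is an upper triangular matrix with all diagonal entries equal to `1`
(upper unitriangular matrix). -/
def IsUniUpperTriangular {n : ℕ} {K : Type*} [CommRing K]
    (u : Matrix (Fin n) (Fin n) K) : Prop :=
  (∀ a : Fin n, u a a = 1) ∧ ∀ a b : Fin n, (b : ℕ) < (a : ℕ) → u a b = 0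

/-- The left lower corner minor `J_k` of order `k`: the determinant of the
`k × k` submatrix of `A` formed by its last `k` rows and first `k` columns. -/
def Jcorner {n : ℕ} {K : Type*} [CommRing K] (k : ℕ) (hk : k ≤ n)
    (A : Matrix (Fin n) (Fin n) K) : K :=
  Matrix.det (Matrix.of fun r c : Fin k =>
    A ⟨n - k + (r : ℕ), by have := r.isLt; omega⟩
      ⟨(c : ℕ), by have := c.isLt; omega⟩)

/-- `B` belongs to `L`: all entries strictly above the anti-diagonal vanish
and all anti-diagonal entries are nonzero. -/
def MemL {n : ℕ} {K : Type*} [CommRing K] (B : Matrix (Fin n) (Fin n) K) : Prop :=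
  (∀ a c : Fin n, (a : ℕ) + (c : ℕ) + 2 ≤ n → B a c = 0) ∧
    ∀ c : Fin n, B ⟨n - 1 - (c : ℕ), by have := c.isLt; omega⟩ c ≠ 0

/-- The corner submatrix. -/
def cornerMat {n : ℕ} {K : Type*} [CommRing K] (k : ℕ) (hk : k ≤ n)
    (A : Matrix (Fin n) (Fin n) K) : Matrix (Fin k) (Fin k) K :=
  Matrix.of fun r c : Fin k =>
    A ⟨n - k + (r : ℕ), by have := r.isLt; omega⟩
      ⟨(c : ℕ), by have := c.isLt; omega⟩

lemma cornerMat_det {n : ℕ} {K : Type*} [Field K] (A : Matrix (Fin n) (Fin n) K)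
    (hA : ∀ k : ℕ, ∀ hk1 : 1 ≤ k, ∀ hk : k ≤ n, Jcorner k hk A ≠ 0) (k : ℕ) (hk : k ≤ n) :
    IsUnit (cornerMat k hk A).det := by
  rcases Nat.eq_zero_or_pos k with h | h
  · subst h
    simp
  · exact isUnit_iff_ne_zero.mpr (hA k h hk)

lemma sum_tail {n : ℕ} {K : Type*} [Field K] (k : ℕ) (hk : k ≤ n) (f : Fin n → K)
    (hf : ∀ j : Fin n, (j : ℕ) < n - k → f j = 0) :
    ∑ j, f j = ∑ r : Fin k, f ⟨n - k + (r : ℕ), by have := r.isLt; omega⟩ := by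
  symm
  refine Finset.sum_of_injOn
    (fun r : Fin k => (⟨n - k + (r : ℕ), by have := r.isLt; omega⟩ : Fin n)) ?_ ?_ ?_ ?_
  · intro r _ s _ h
    simp only [Fin.mk.injEq] at h
    ext
    omega
  · intro r _
    simp
  · intro j _ hj
    apply hf
    by_contra hlt
    apply hj
    refine ⟨⟨(j : ℕ) - (n - k), by have := j.isLt; omega⟩, by simp, ?_⟩
    ext
    simp only
    omega
  · intro r _
    rfl

lemma row_exists {n : ℕ} {K : Type*} [Field K] (A : Matrix (Fin n) (Fin n) K)
    (hA : ∀ k : ℕ, ∀ hk1 : 1 ≤ k, ∀ hk : k ≤ n, Jcorner k hk A ≠ 0) (a : Fin n) :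
    ∃ y : Fin n → K, (∀ j : Fin n, (j : ℕ) ≤ a → y j = 0) ∧
      ∀ c : Fin n, (a : ℕ) + c + 2 ≤ n → ∑ j, y j * A j c = - A a c := by
  have ha := a.isLt
  obtain ⟨k, hk, hka⟩ : ∃ k, k ≤ n ∧ n - k = a + 1 := ⟨n - 1 - a, by omega, by omega⟩
  have hu := cornerMat_det A hA k hk
  let b : Fin k → K := fun c => - A a ⟨c, by have := c.isLt; omega⟩
  let x : Fin k → K := b ᵥ* (cornerMat k hk A)⁻¹
  have hx : x ᵥ* cornerMat k hk A = b := by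
    simp only [x, Matrix.vecMul_vecMul, Matrix.nonsing_inv_mul _ hu, Matrix.vecMul_one]
  refine ⟨fun j => if h : (j : ℕ) ≤ a then 0 else x ⟨(j : ℕ) - (n - k), by
    have := j.isLt; omega⟩, ?_, ?_⟩
  · intro j hj
    simp [hj]
  · intro c hc
    rw [sum_tail k hk]
    · have h := congrFun hx ⟨c, by omega⟩
      simp only [b, Matrix.vecMul, dotProduct, cornerMat, Matrix.of_apply] at h
      rw [← h]
      refine Finset.sum_congr rfl fun r _ => ?_
      beta_reduce
      rw [dif_neg (by simp only; omega)]
      simp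
    · intro j hj
      beta_reduce
      rw [dif_pos (by omega), zero_mul]

lemma row_unique {n : ℕ} {K : Type*} [Field K] (A : Matrix (Fin n) (Fin n) K)
    (hA : ∀ k : ℕ, ∀ hk1 : 1 ≤ k, ∀ hk : k ≤ n, Jcorner k hk A ≠ 0) (a : Fin n)
    (y : Fin n → K) (hy : ∀ j : Fin n, (j : ℕ) ≤ a → y j = 0)
    (hz : ∀ c : Fin n, (a : ℕ) + c + 2 ≤ n → ∑ j, y j * A j c = 0) : y = 0 := by
  have ha := a.isLt
  obtain ⟨k, hk, hka⟩ : ∃ k, k ≤ n ∧ n - k = a + 1 := ⟨n - 1 - a, by omega, by omega⟩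
  have hu := cornerMat_det A hA k hk
  let x : Fin k → K := fun r => y ⟨n - k + (r : ℕ), by have := r.isLt; omega⟩
  have hx : x ᵥ* cornerMat k hk A = 0 := by
    ext c
    have h := hz ⟨c, by have := c.isLt; omega⟩ (by have := c.isLt; simp only; omega)
    rw [sum_tail k hk _ (fun j hj => by rw [hy j (by omega), zero_mul])] at h
    exact h
  have hx0 : x = 0 := by
    have := congrArg (fun z => z ᵥ* (cornerMat k hk A)⁻¹) hx
    simpa [Matrix.vecMul_vecMul, Matrix.mul_nonsing_inv _ hu] using this
  ext j
  by_cases hj : (j : ℕ) ≤ a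
  · exact hy j hj
  · have h := congrFun hx0 ⟨(j : ℕ) - (n - k), by have := j.isLt; omega⟩
    simp only [x, Pi.zero_apply] at h
    rw [Pi.zero_apply, ← h]
    congr 1
    ext
    simp only
    omega

lemma uni_det {n : ℕ} {K : Type*} [Field K] {u : Matrix (Fin n) (Fin n) K}
    (hu : IsUniUpperTriangular u) : u.det = 1 := by
  rw [Matrix.det_of_upperTriangular (fun i j h => hu.2 i j h)]
  simp [hu.1]

lemma zeros_mul {n : ℕ} {K : Type*} [Field K] {C w : Matrix (Fin n) (Fin n) K}
    (hC : ∀ a c : Fin n, (a : ℕ) + (c : ℕ) + 2 ≤ n → C a c = 0)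
    (hw : ∀ a b : Fin n, (b : ℕ) < (a : ℕ) → w a b = 0) :
    ∀ a c : Fin n, (a : ℕ) + (c : ℕ) + 2 ≤ n → (C * w) a c = 0 := by
  intro a c h
  rw [Matrix.mul_apply]
  refine Finset.sum_eq_zero fun j _ => ?_
  by_cases hj : (c : ℕ) < j
  · rw [hw _ _ hj, mul_zero]
  · rw [hC a j (by omega), zero_mul]

lemma uni_inv {n : ℕ} {K : Type*} [Field K] {u : Matrix (Fin n) (Fin n) K}
    (hu : IsUniUpperTriangular u) : ∀ a b : Fin n, (b : ℕ) < (a : ℕ) → u⁻¹ a b = 0 := by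
  have hd : IsUnit u.det := by rw [uni_det hu]; exact isUnit_one
  haveI : Invertible u := Matrix.invertibleOfIsUnitDet u hd
  have hb : Matrix.BlockTriangular u (id : Fin n → Fin n) := fun i j h => hu.2 i j h
  have := Matrix.blockTriangular_inv_of_blockTriangular hb
  exact fun a b h => this h

lemma anti_ne {n : ℕ} {K : Type*} [Field K] {B : Matrix (Fin n) (Fin n) K}
    (hB : ∀ a c : Fin n, (a : ℕ) + (c : ℕ) + 2 ≤ n → B a c = 0) (hd : B.det ≠ 0) : MemL B := by
  refine ⟨hB, ?_⟩
  have h1 : (B.submatrix (Fin.revPerm : Equiv.Perm (Fin n)) id).det ≠ 0 := by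
    rw [Matrix.det_permute]
    refine mul_ne_zero ?_ hd
    rcases Int.units_eq_one_or (Equiv.Perm.sign (Fin.revPerm : Equiv.Perm (Fin n))) with h | h <;>
      rw [h] <;> simp
  rw [Matrix.det_of_upperTriangular, Finset.prod_ne_zero_iff] at h1
  · intro c
    have h := h1 c (Finset.mem_univ _)
    simp only [Matrix.submatrix_apply, id, Fin.revPerm_apply] at h
    convert h using 2
    ext
    simp only [Fin.val_rev]
    omega
  · intro i j h
    have h' : (j : ℕ) < i := h
    apply hB
    simp only [Fin.revPerm_apply, Fin.val_rev, id]
    have := i.isLt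
    omega

/-- If all left lower corner minors of `A` are nonzero, then the `Ad_U`-orbit
of `A` meets `L` in exactly one point. -/
theorem adU_orbit_meets_L_uniquely {n : ℕ} {K : Type*} [Field K] [CharZero K]
    (hn : 1 ≤ n) (A : Matrix (Fin n) (Fin n) K)
    (hA : ∀ k : ℕ, ∀ hk1 : 1 ≤ k, ∀ hk : k ≤ n, Jcorner k hk A ≠ 0) :
    (∃ u : Matrix (Fin n) (Fin n) K,
        IsUniUpperTriangular u ∧ MemL (u * A * u⁻¹)) ∧
    ∀ u v : Matrix (Fin n) (Fin n) K,
      IsUniUpperTriangular u → IsUniUpperTriangular v →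
      MemL (u * A * u⁻¹) → MemL (v * A * v⁻¹) →
      u * A * u⁻¹ = v * A * v⁻¹ := by
  constructor
  · choose Y hY0 hY using row_exists A hA
    let u : Matrix (Fin n) (Fin n) K := 1 + Matrix.of Y
    have hu : IsUniUpperTriangular u := by
      constructor
      · intro a
        simp [u, hY0 a a le_rfl]
      · intro a b h
        have hne : a ≠ b := by rintro rfl; omega
        simp [u, hY0 a b h.le, Matrix.one_apply_ne hne]
    refine ⟨u, hu, ?_⟩
    apply anti_ne
    · apply zeros_mul _ (uni_inv hu)
      intro a c h
      have := hY a c h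
      rw [show u * A = A + Matrix.of Y * A by simp only [u, add_mul, one_mul],
        Matrix.add_apply, Matrix.mul_apply]
      simp only [Matrix.of_apply]
      rw [this, add_neg_cancel]
    · have h0 : A.det ≠ 0 := by
        have h := hA n hn le_rfl
        unfold Jcorner at h
        convert h using 2
        ext r c
        simp
      rw [Matrix.det_mul, Matrix.det_mul, Matrix.det_nonsing_inv, uni_det hu]
      simpa using h0
  · intro u v hu hv hLu hLv
    have key : ∀ w : Matrix (Fin n) (Fin n) K, IsUniUpperTriangular w → MemL (w * A * w⁻¹) →
        ∀ a c : Fin n, (a : ℕ) + (c : ℕ) + 2 ≤ n → (w * A) a c = 0 := by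
      intro w hw hL
      have h := zeros_mul hL.1 hw.2
      rwa [Matrix.nonsing_inv_mul_cancel_right _ _ (by rw [uni_det hw]; exact isUnit_one)] at h
    have huv : u = v := by
      ext a j
      have h := row_unique A hA a (fun j => u a j - v a j) ?_ ?_
      · exact sub_eq_zero.mp (congrFun h j)
      · intro j hj
        rcases hj.lt_or_eq with h | h
        · simp [hu.2 a j h, hv.2 a j h]
        · have : j = a := Fin.ext h
          subst this
          simp [hu.1, hv.1]
      · intro c hc
        have h1 := key u hu hLu a c hc
        have h2 := key v hv hLv a c hc
        rw [Matrix.mul_apply] at h1 h2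
        simp only [sub_mul, Finset.sum_sub_distrib, h1, h2, sub_zero]
    rw [huv]
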